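/- For every ε ∈ (0,1) there exists a constant C > 0 such that for all integers n ≥ 2, all Δ ∈ (0, 1-ε], and all horizons t ≥ 1, the optimal mutual information satisfies I*_t ≤ C·Δ²·Σ_{s=0}^{t-1} p*_s, where p*_s is the optimal success probability at horizon s. -/

import Mathlib

open scoped BigOperators

noncomputable section

/-- Probability that pulling arm `a` yields reward `r : Bool` (with `true` = reward 1),
when the best arm is `astar`: `Bernoulli ((1+Δ)/2)` if `a = astar`, else `Bernoulli ((1-Δ)/2)`. -/
def rewP (n : ℕ) (Δ : ℝ) (astar a : Fin n) (r : Bool) : ℝ :=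
  if r then (if a = astar then (1 + Δ) / 2 else (1 - Δ) / 2)
  else 1 - (if a = astar then (1 + Δ) / 2 else (1 - Δ) / 2)

/-- An interactive algorithm: for every history (recorded with the most recent pull first),
a probability distribution over the `n` arms used to draw the next pull. -/
def IsAlg (n : ℕ) (alg : List (Fin n × Bool) → Fin n → ℝ) : Prop :=
  ∀ h : List (Fin n × Bool), (∀ a, 0 ≤ alg h a) ∧ (∑ a : Fin n, alg h a) = 1

/-- Probability, conditionally on the best arm `astar`, of observing a given history
(recorded with the most recent pull first) when running the algorithm `alg`. -/
def histP (n : ℕ) (alg : List (Fin n × Bool) → Fin n → ℝ) (Δ : ℝ) (astar : Fin n) :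
    List (Fin n × Bool) → ℝ
  | [] => 1
  | (a, r) :: prev => histP n alg Δ astar prev * alg prev a * rewP n Δ astar a r

/-- The reversed history (most recent pull first) associated with a tuple of `t` pulls. -/
def hist {n t : ℕ} (h : Fin t → Fin n × Bool) : List (Fin n × Bool) :=
  (List.ofFn h).reverse

/-- Success probability `P(a_{t+1} = a*)` of an interactive algorithm after `t` rounds,
under the uniform prior on the best arm. -/
def succProb (n t : ℕ) (alg : List (Fin n × Bool) → Fin n → ℝ) (Δ : ℝ) : ℝ :=
  ((n : ℝ))⁻¹ * ∑ astar : Fin n, ∑ h : Fin t → Fin n × Bool,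
    histP n alg Δ astar (hist h) * alg (hist h) astar

/-- Mutual information (in nats) `I(a*; H_t)` accumulated by an interactive algorithm. -/
def mutualInfo (n t : ℕ) (alg : List (Fin n × Bool) → Fin n → ℝ) (Δ : ℝ) : ℝ :=
  ∑ astar : Fin n, ∑ h : Fin t → Fin n × Bool,
    ((n : ℝ))⁻¹ * histP n alg Δ astar (hist h) *
      Real.log (histP n alg Δ astar (hist h) /
        (((n : ℝ))⁻¹ * ∑ b : Fin n, histP n alg Δ b (hist h)))

/-- Optimal success probability `p*_t`. -/
def pStar (n t : ℕ) (Δ : ℝ) : ℝ :=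
  sSup {x : ℝ | ∃ alg, IsAlg n alg ∧ x = succProb n t alg Δ}

/-- Optimal mutual information `I*_t`. -/
def IStar (n t : ℕ) (Δ : ℝ) : ℝ :=
  sSup {x : ℝ | ∃ alg, IsAlg n alg ∧ x = mutualInfo n t alg Δ}

theorem hist_snoc {n t : ℕ} (h : Fin t → Fin n × Bool) (x : Fin n × Bool) :
    hist (Fin.snoc h x : Fin (t + 1) → Fin n × Bool) = x :: hist h := by
  rw [hist, List.ofFn_succ']
  simp [hist]

/-- Summing over histories of length `t + 1` by splitting off the most recent pull. -/
theorem sum_hist_succ {n t : ℕ} (F : List (Fin n × Bool) → ℝ) :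
    ∑ h : Fin (t + 1) → Fin n × Bool, F (hist h) =
      ∑ h : Fin t → Fin n × Bool, ∑ a : Fin n, ∑ r : Bool, F ((a, r) :: hist h) := by
  rw [← (Fin.snocEquiv fun _ : Fin (t + 1) => Fin n × Bool).sum_comp, Fintype.sum_prod_type,
    Finset.sum_comm]
  refine Finset.sum_congr rfl fun h _ => ?_
  rw [← Fintype.sum_prod_type' (f := fun a r => F ((a, r) :: hist h))]
  exact Finset.sum_congr rfl fun x _ => congrArg F (hist_snoc h x)

theorem rewP_pos {n : ℕ} {Δ : ℝ} (h0 : 0 < Δ) (h1 : Δ < 1) (b a : Fin n) (r : Bool) :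
    0 < rewP n Δ b a r := by
  unfold rewP
  split_ifs <;> linarith

theorem sum_rewP (n : ℕ) (Δ : ℝ) (b a : Fin n) : ∑ r : Bool, rewP n Δ b a r = 1 := by
  simp [rewP]

theorem histP_nonneg {n : ℕ} {alg : List (Fin n × Bool) → Fin n → ℝ} {Δ : ℝ} (halg : IsAlg n alg)
    (h0 : 0 < Δ) (h1 : Δ < 1) (b : Fin n) (l : List (Fin n × Bool)) :
    0 ≤ histP n alg Δ b l := by
  induction l with
  | nil => exact zero_le_one
  | cons x l ih =>
    exact mul_nonneg (mul_nonneg ih ((halg l).1 x.1)) (rewP_pos h0 h1 b x.1 x.2).le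

theorem sum_histP {n : ℕ} {alg : List (Fin n × Bool) → Fin n → ℝ} (Δ : ℝ) (halg : IsAlg n alg)
    (b : Fin n) (t : ℕ) :
    ∑ h : Fin t → Fin n × Bool, histP n alg Δ b (hist h) = 1 := by
  induction t with
  | zero => simp [hist, histP]
  | succ t ih =>
    rw [sum_hist_succ, ← ih]
    refine Finset.sum_congr rfl fun h _ => ?_
    simp only [histP, ← Finset.mul_sum, sum_rewP, mul_one, (halg _).2]

theorem succProb_le_one {n t : ℕ} {alg : List (Fin n × Bool) → Fin n → ℝ} {Δ : ℝ}
    (halg : IsAlg n alg) (h0 : 0 < Δ) (h1 : Δ < 1) : succProb n t alg Δ ≤ 1 := by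
  have key : ∑ b : Fin n, ∑ h : Fin t → Fin n × Bool,
      histP n alg Δ b (hist h) * alg (hist h) b ≤ n := by
    calc _ ≤ ∑ b : Fin n, ∑ h : Fin t → Fin n × Bool, histP n alg Δ b (hist h) := by
          refine Finset.sum_le_sum fun b _ => Finset.sum_le_sum fun h _ => ?_
          refine mul_le_of_le_one_right (histP_nonneg halg h0 h1 _ _) ?_
          rw [← (halg (hist h)).2]
          exact Finset.single_le_sum (fun a _ => (halg (hist h)).1 a) (Finset.mem_univ b)
      _ = n := by simp [sum_histP Δ halg]
  calc succProb n t alg Δ ≤ (n : ℝ)⁻¹ * n := mul_le_mul_of_nonneg_left key (by positivity)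
    _ ≤ 1 := inv_mul_le_one

theorem succProb_le_pStar {n t : ℕ} {alg : List (Fin n × Bool) → Fin n → ℝ} {Δ : ℝ}
    (halg : IsAlg n alg) (h0 : 0 < Δ) (h1 : Δ < 1) : succProb n t alg Δ ≤ pStar n t Δ := by
  refine le_csSup ⟨1, ?_⟩ ⟨alg, halg, rfl⟩
  rintro x ⟨alg', halg', rfl⟩
  exact succProb_le_one halg' h0 h1

/-- Reward law of a suboptimal arm. -/
def nullRew (Δ : ℝ) (r : Bool) : ℝ := if r then (1 - Δ) / 2 else (1 + Δ) / 2

theorem nullRew_pos {Δ : ℝ} (h0 : 0 < Δ) (h1 : Δ < 1) (r : Bool) : 0 < nullRew Δ r := by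
  unfold nullRew
  split_ifs <;> linarith

theorem rewP_of_ne {n : ℕ} (Δ : ℝ) {b a : Fin n} (h : a ≠ b) (r : Bool) :
    rewP n Δ b a r = nullRew Δ r := by
  cases r
  · simp only [rewP, nullRew, h, if_false, Bool.false_eq_true]
    ring
  · simp [rewP, nullRew, h]

/-- The Kullback–Leibler divergence between the optimal and the suboptimal reward laws. -/
theorem sum_rewP_log_le {n : ℕ} {ε Δ : ℝ} (hε : 0 < ε) (h0 : 0 < Δ) (h1 : Δ ≤ 1 - ε) (a : Fin n) :
    ∑ r : Bool, rewP n Δ a a r * Real.log (rewP n Δ a a r / nullRew Δ r) ≤ 2 / ε * Δ ^ 2 := by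
  have hm : 0 < 1 - Δ := by linarith
  have hp : 0 < 1 + Δ := by linarith
  have hf : rewP n Δ a a false = (1 - Δ) / 2 := by
    simp only [rewP, if_true, Bool.false_eq_true, if_false]
    ring
  have ht : rewP n Δ a a true = (1 + Δ) / 2 := by simp [rewP]
  have e1 : (1 + Δ) / 2 / ((1 - Δ) / 2) = (1 + Δ) / (1 - Δ) := by field_simp
  have e2 : (1 - Δ) / 2 / ((1 + Δ) / 2) = ((1 + Δ) / (1 - Δ))⁻¹ := by field_simp
  have hlog : Real.log ((1 + Δ) / (1 - Δ)) ≤ 2 * Δ / ε := by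
    calc Real.log ((1 + Δ) / (1 - Δ)) ≤ (1 + Δ) / (1 - Δ) - 1 :=
          Real.log_le_sub_one_of_pos (by positivity)
      _ = 2 * Δ / (1 - Δ) := by field_simp; ring
      _ ≤ 2 * Δ / ε := div_le_div_of_nonneg_left (by positivity) hε (by linarith)
  rw [Fintype.sum_bool, hf, ht]
  simp only [nullRew, if_true, Bool.false_eq_true, if_false]
  rw [e1, e2, Real.log_inv]
  calc _ = Δ * Real.log ((1 + Δ) / (1 - Δ)) := by ring
    _ ≤ Δ * (2 * Δ / ε) := mul_le_mul_of_nonneg_left hlog h0.le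
    _ = 2 / ε * Δ ^ 2 := by ring

/-- Splitting the log-likelihood ratio after one more pull, with `log x ≤ x - 1` applied to the
mixture term. -/
theorem mul_log_mixture_le {c p q R Z Q M : ℝ} (hc : 0 < c) (hp : 0 ≤ p) (hq : 0 ≤ q)
    (hR : 0 < R) (hQ : 0 < Q) (hZ : c * p ≤ Z) (hM : c * (p * R) ≤ M) :
    c * (p * q * R) * Real.log (p * q * R / (q * M)) ≤
      c * p * Real.log (p / Z) * (q * R) + c * p * q * (R * Real.log (R / Q)) +
        q * (Q * Z / M - 1) * (c * (p * R)) := by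
  rcases hp.eq_or_lt with rfl | hp
  · simp
  rcases hq.eq_or_lt with rfl | hq
  · simp
  have hZ' : 0 < Z := lt_of_lt_of_le (by positivity) hZ
  have hM' : 0 < M := lt_of_lt_of_le (by positivity) hM
  have e : p * q * R / (q * M) = p / Z * (R / Q) * (Q * Z / M) := by field_simp
  have hl : Real.log (Q * Z / M) ≤ Q * Z / M - 1 := Real.log_le_sub_one_of_pos (by positivity)
  rw [e, Real.log_mul (by positivity) (by positivity), Real.log_mul (by positivity) (by positivity)]
  have := mul_le_mul_of_nonneg_left hl (show 0 ≤ c * (p * q * R) by positivity)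
  linarith

/-- One more pull after the history `l` increases the information by at most the divergence
between the two reward laws times the probability of pulling the best arm. -/
theorem info_cons_le {n : ℕ} (hn : 2 ≤ n) {alg : List (Fin n × Bool) → Fin n → ℝ} {ε Δ : ℝ}
    (halg : IsAlg n alg) (hε : 0 < ε) (h0 : 0 < Δ) (h1 : Δ ≤ 1 - ε) (l : List (Fin n × Bool)) :
    ∑ a : Fin n, ∑ r : Bool, ∑ b : Fin n, (n : ℝ)⁻¹ * histP n alg Δ b ((a, r) :: l) *
      Real.log (histP n alg Δ b ((a, r) :: l) /
        ((n : ℝ)⁻¹ * ∑ b' : Fin n, histP n alg Δ b' ((a, r) :: l))) ≤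
    ∑ b : Fin n, (n : ℝ)⁻¹ * histP n alg Δ b l *
      Real.log (histP n alg Δ b l / ((n : ℝ)⁻¹ * ∑ b' : Fin n, histP n alg Δ b' l)) +
    2 / ε * Δ ^ 2 * ((n : ℝ)⁻¹ * ∑ b : Fin n, histP n alg Δ b l * alg l b) := by
  have hΔ : Δ < 1 := by linarith
  have hc : 0 < (n : ℝ)⁻¹ := inv_pos.2 (by exact_mod_cast (by omega : 0 < n))
  set c := (n : ℝ)⁻¹
  set p : Fin n → ℝ := fun b => histP n alg Δ b l
  have hp : ∀ b, 0 ≤ p b := fun b => histP_nonneg halg h0 hΔ b l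
  set Z : ℝ := c * ∑ b, p b with hZdef
  set I : ℝ := ∑ b, c * p b * Real.log (p b / Z) with hI
  set M : Fin n → Bool → ℝ := fun a r => ∑ b, c * (p b * rewP n Δ b a r) with hM
  have hZ : ∀ b, c * p b ≤ Z := fun b => mul_le_mul_of_nonneg_left
    (Finset.single_le_sum (fun i _ => hp i) (Finset.mem_univ b)) hc.le
  have hterm : ∀ a r b, 0 ≤ c * (p b * rewP n Δ b a r) := fun a r b =>
    mul_nonneg hc.le (mul_nonneg (hp b) (rewP_pos h0 hΔ b a r).le)
  have hMb : ∀ a r b, c * (p b * rewP n Δ b a r) ≤ M a r := fun a r b =>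
    Finset.single_le_sum (f := fun b => c * (p b * rewP n Δ b a r))
      (fun i _ => hterm a r i) (Finset.mem_univ b)
  have hmix : ∀ a r, c * ∑ b, histP n alg Δ b ((a, r) :: l) = alg l a * M a r := by
    intro a r
    simp only [hM, histP, Finset.mul_sum]
    exact Finset.sum_congr rfl fun b _ => by ring
  have hMsum : ∀ a, ∑ r, M a r = Z := by
    intro a
    rw [Finset.sum_comm]
    simp only [← Finset.mul_sum, sum_rewP, mul_one, hZdef]
  have hcancel : ∀ a r, (nullRew Δ r * Z / M a r - 1) * M a r ≤ nullRew Δ r * Z - M a r := by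
    intro a r
    rcases eq_or_ne (M a r) 0 with h | h
    · have : 0 ≤ Z := mul_nonneg hc.le (Finset.sum_nonneg fun b _ => hp b)
      simpa [h] using mul_nonneg (nullRew_pos h0 hΔ r).le this
    · rw [sub_mul, div_mul_cancel₀ _ h, one_mul]
  have hnull : ∑ r, nullRew Δ r = 1 := by
    simp [nullRew]
    ring
  have harm : ∀ a, ∑ r : Bool, ∑ b : Fin n, c * histP n alg Δ b ((a, r) :: l) *
      Real.log (histP n alg Δ b ((a, r) :: l) /
        (c * ∑ b' : Fin n, histP n alg Δ b' ((a, r) :: l))) ≤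
      I * alg l a + 2 / ε * Δ ^ 2 * (c * (p a * alg l a)) := by
    intro a
    have hq := (halg l).1 a
    have hkl : ∀ r, ∑ b, c * p b * alg l a *
        (rewP n Δ b a r * Real.log (rewP n Δ b a r / nullRew Δ r)) =
        c * p a * alg l a * (rewP n Δ a a r * Real.log (rewP n Δ a a r / nullRew Δ r)) := by
      intro r
      refine Finset.sum_eq_single a (fun b _ hb => ?_) (by simp)
      rw [rewP_of_ne Δ hb.symm, div_self (nullRew_pos h0 hΔ r).ne']
      simp
    calc _ ≤ ∑ r : Bool, ∑ b : Fin n,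
          (c * p b * Real.log (p b / Z) * (alg l a * rewP n Δ b a r) +
            c * p b * alg l a * (rewP n Δ b a r * Real.log (rewP n Δ b a r / nullRew Δ r)) +
            alg l a * (nullRew Δ r * Z / M a r - 1) * (c * (p b * rewP n Δ b a r))) := by
          refine Finset.sum_le_sum fun r _ => Finset.sum_le_sum fun b _ => ?_
          rw [hmix]
          exact mul_log_mixture_le hc (hp b) hq (rewP_pos h0 hΔ b a r) (nullRew_pos h0 hΔ r)
            (hZ b) (hMb a r b)
      _ = I * alg l a +
          c * p a * alg l a *
            ∑ r, rewP n Δ a a r * Real.log (rewP n Δ a a r / nullRew Δ r) +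
          alg l a * ∑ r, (nullRew Δ r * Z / M a r - 1) * M a r := by
          simp only [Finset.sum_add_distrib, hkl]
          congr 1
          · congr 1
            · rw [Finset.sum_comm, hI, Finset.sum_mul]
              simp only [← Finset.mul_sum, sum_rewP, mul_one]
            · rw [Finset.mul_sum]
          · simp only [← Finset.mul_sum, hM, mul_assoc]
      _ ≤ I * alg l a + c * p a * alg l a * (2 / ε * Δ ^ 2) +
          alg l a * ∑ r, (nullRew Δ r * Z - M a r) := by
          have hw : 0 ≤ c * p a * alg l a := mul_nonneg (mul_nonneg hc.le (hp a)) hq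
          have := mul_le_mul_of_nonneg_left (sum_rewP_log_le hε h0 h1 a) hw
          have := mul_le_mul_of_nonneg_left
            (Finset.sum_le_sum fun r (_ : r ∈ Finset.univ) => hcancel a r) hq
          linarith
      _ = _ := by
          rw [Finset.sum_sub_distrib, ← Finset.sum_mul, hnull, hMsum]
          ring
  calc _ ≤ ∑ a, (I * alg l a + 2 / ε * Δ ^ 2 * (c * (p a * alg l a))) :=
        Finset.sum_le_sum fun a _ => harm a
    _ = _ := by
        rw [Finset.sum_add_distrib, ← Finset.mul_sum, (halg l).2, mul_one]
        simp only [Finset.mul_sum, p]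

theorem mutualInfo_zero {n : ℕ} (hn : 2 ≤ n) (alg : List (Fin n × Bool) → Fin n → ℝ) (Δ : ℝ) :
    mutualInfo n 0 alg Δ = 0 := by
  have : (n : ℝ) ≠ 0 := by exact_mod_cast (by omega : n ≠ 0)
  simp [mutualInfo, hist, histP, this]

theorem mutualInfo_succ_le {n t : ℕ} (hn : 2 ≤ n) {alg : List (Fin n × Bool) → Fin n → ℝ}
    {ε Δ : ℝ} (halg : IsAlg n alg) (hε : 0 < ε) (h0 : 0 < Δ) (h1 : Δ ≤ 1 - ε) :
    mutualInfo n (t + 1) alg Δ ≤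
      mutualInfo n t alg Δ + 2 / ε * Δ ^ 2 * succProb n t alg Δ := by
  unfold mutualInfo succProb
  rw [Finset.sum_comm, sum_hist_succ (fun l => ∑ b : Fin n, (n : ℝ)⁻¹ * histP n alg Δ b l *
    Real.log (histP n alg Δ b l / ((n : ℝ)⁻¹ * ∑ b' : Fin n, histP n alg Δ b' l)))]
  refine (Finset.sum_le_sum fun h _ => info_cons_le hn halg hε h0 h1 (hist h)).trans_eq ?_
  rw [Finset.sum_add_distrib, Finset.sum_comm]
  congr 1
  rw [← Finset.mul_sum, ← Finset.mul_sum, Finset.sum_comm]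

theorem mutualInfo_le {n : ℕ} (hn : 2 ≤ n) {alg : List (Fin n × Bool) → Fin n → ℝ}
    {ε Δ : ℝ} (halg : IsAlg n alg) (hε : 0 < ε) (h0 : 0 < Δ) (h1 : Δ ≤ 1 - ε) (t : ℕ) :
    mutualInfo n t alg Δ ≤ 2 / ε * Δ ^ 2 * ∑ s ∈ Finset.range t, pStar n s Δ := by
  induction t with
  | zero => simp [mutualInfo_zero hn]
  | succ t ih =>
    have hs : 2 / ε * Δ ^ 2 * succProb n t alg Δ ≤ 2 / ε * Δ ^ 2 * pStar n t Δ :=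
      mul_le_mul_of_nonneg_left (succProb_le_pStar halg h0 (by linarith)) (by positivity)
    rw [Finset.sum_range_succ, mul_add]
    exact (mutualInfo_succ_le hn halg hε h0 h1).trans (add_le_add ih hs)

theorem exists_isAlg {n : ℕ} (hn : 2 ≤ n) : ∃ alg, IsAlg n alg :=
  ⟨fun _ a => if a = ⟨0, by omega⟩ then 1 else 0, fun _ =>
    ⟨fun a => by dsimp only; split_ifs <;> norm_num, by simp⟩⟩

/-- Information accumulation bound: for every `ε ∈ (0,1)` there is `C > 0` such that for all
`n ≥ 2`, `Δ ∈ (0, 1-ε]` and horizons `t ≥ 1`, `I*_t ≤ C Δ² ∑_{s=0}^{t-1} p*_s`. -/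
theorem bandit_info_accumulation :
    ∀ ε : ℝ, ε ∈ Set.Ioo (0 : ℝ) 1 → ∃ C : ℝ, 0 < C ∧
      ∀ n : ℕ, 2 ≤ n → ∀ Δ : ℝ, Δ ∈ Set.Ioc (0 : ℝ) (1 - ε) →
        ∀ t : ℕ, 1 ≤ t →
          IStar n t Δ ≤ C * Δ ^ 2 * ∑ s ∈ Finset.range t, pStar n s Δ := by
  intro ε hε
  refine ⟨2 / ε, div_pos two_pos hε.1, fun n hn Δ hΔ t _ => ?_⟩
  obtain ⟨alg, halg⟩ := exists_isAlg hn
  refine csSup_le ⟨_, alg, halg, rfl⟩ ?_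
  rintro x ⟨alg', halg', rfl⟩
  exact mutualInfo_le hn halg' hε.1 hΔ.1 hΔ.2 t
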